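/- (Efficient competitive equilibrium, concave utility.) Suppose r ∈ ℕ^T is nonincreasing, U : {0,…,T} → ℝ satisfies U(0) = 0 and has nonnegative, nonincreasing increments, N > ∑_{t=1}^T r_t, and c ≥ 0. Define k* = max{ k ∈ {1,…,T} : U(k) − U(k−1) ≥ c } if this set is nonempty, and k* = 0 otherwise. Then the following is an efficient competitive equilibrium: prices π(h) = min(c, U(1)) · h for h = 0,…,T; production n given by (if k* ≥ 1) n_{k*} = N and n_t = 0 for t ≠ k*, and (if k* = 0) n_1 = ∑_{t=1}^T r_t and n_t = 0 for t > 1; and consumption in which exactly n_t consumers purchase the duration-t service. In particular, under these prices each consumer's choice maximizes U(h) − π(h), the production n (with an optimal purchase vector y) maximizes the supplier's profit ∑_t n_t π(t) − c ∑_t y_t subject to d_t = ∑_{i=t}^T n_i and d ⪯^w (r + y), the market clears, and the resulting allocation maximizes social welfare ∑_i U(h_i) − c ∑_t y_t. -/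

import Mathlib

open Finset

/-- The nonincreasing rearrangement `a↓` of `a`. -/
def sortedDesc {T : ℕ} (a : Fin T → ℕ) : Fin T → ℕ := fun t => a (Tuple.sort a t.rev)

/-- The demand-duration vector of the demand profile `h`:
`d t` is the number of consumers demanding at least `t+1` slots (`t` is 0-indexed). -/
def durations {T N : ℕ} (h : Fin N → ℕ) : Fin T → ℕ :=
  fun t => (univ.filter fun i => (t : ℕ) < h i).card

/-- Weak majorization `d ⪯^w p` for a nonincreasing `d`: every tail sum of `d`
is at most the corresponding tail sum of the nonincreasing rearrangement `p↓`
(this is adequacy of the supply `p` for the demand-duration vector `d`). -/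
def MajW {T : ℕ} (d p : Fin T → ℕ) : Prop :=
  ∀ t : Fin T, ∑ s ∈ Ici t, d s ≤ ∑ s ∈ Ici t, sortedDesc p s

/-- The demand-duration vector of a service production vector `n`
(`n t` = number of duration-`(t+1)` services produced): `d_t = ∑_{i=t}^T n_i`. -/
def prodDurations {T : ℕ} (n : Fin T → ℕ) : Fin T → ℕ :=
  fun t => ∑ s ∈ Ici t, n s

lemma sortedDesc_of_antitone {T : ℕ} {p : Fin T → ℕ} (hp : Antitone p) : sortedDesc p = p := by
  have hmono : Monotone (p ∘ Fin.revPerm) := fun a b hab => hp (Fin.rev_le_rev.2 hab)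
  have h := Tuple.comp_sort_eq_comp_iff_monotone.2 hmono
  funext t
  have ht := congrFun h t.rev
  simpa [sortedDesc] using ht.symm

lemma sum_sortedDesc {T : ℕ} (p : Fin T → ℕ) : ∑ t, sortedDesc p t = ∑ t, p t :=
  Equiv.sum_comp (Fin.revPerm.trans (Tuple.sort p)) p

lemma MajW.sum_le {T : ℕ} {d p : Fin T → ℕ} (h : MajW d p) : ∑ t, d t ≤ ∑ t, p t := by
  rcases T with _ | T
  · simp
  · have h0 := h 0
    have hIci : (Ici (0 : Fin (T + 1))) = univ := by ext; simp
    rwa [hIci, sum_sortedDesc] at h0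

lemma sum_prodDurations {T : ℕ} (n : Fin T → ℕ) :
    ∑ t, prodDurations n t = ∑ t : Fin T, n t * ((t : ℕ) + 1) := by
  unfold prodDurations
  rw [sum_comm' (t' := univ) (s' := fun s => Iic s) (by simp)]
  simp [mul_comm]

lemma sum_durations {T N : ℕ} (h : Fin N → ℕ) (hT : ∀ i, h i ≤ T) :
    ∑ t, durations (T := T) h t = ∑ i, h i := by
  simp only [durations, card_filter]
  rw [sum_comm]
  refine sum_congr rfl fun i _ => ?_
  rw [← card_filter, Fin.card_filter_val_lt]
  simpa using hT i

lemma prodDurations_single {T : ℕ} (k : Fin T) (M : ℕ) (t : Fin T) :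
    prodDurations (fun s => if s = k then M else 0) t = if t ≤ k then M else 0 := by
  simp [prodDurations]

/-- A demand of `M` services of duration `k` is met by any nonincreasing supply which equals `M`
before slot `k` and whose remaining total is `M`. -/
lemma majW_prodDurations_single {T : ℕ} {k : Fin T} {M : ℕ} {p : Fin T → ℕ} (hp : Antitone p)
    (hlt : ∀ s < k, p s = M) (htail : ∑ s ∈ Ici k, p s = M) :
    MajW (prodDurations fun s => if s = k then M else 0) p := by
  intro t
  simp only [sortedDesc_of_antitone hp, prodDurations_single]
  rcases le_or_gt t k with htk | htk
  · have hsplit : Ici t = Ico t k ∪ Ici k := by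
      ext s
      simp only [mem_Ici, mem_union, mem_Ico]
      grind
    have hdisj : Disjoint (Ico t k) (Ici k) :=
      disjoint_left.2 fun s hs hs' => absurd (mem_Ico.1 hs).2 (not_lt.2 (mem_Ici.1 hs'))
    rw [hsplit, sum_union hdisj, sum_union hdisj, htail]
    refine add_le_add (sum_le_sum fun s hs => ?_) ?_
    · rw [hlt s (mem_Ico.1 hs).2]
      split_ifs <;> simp
    · refine (sum_eq_single_of_mem k (by simp) fun s hs hsk => ?_).trans_le (by simp)
      exact if_neg (not_le.2 (lt_of_le_of_ne (mem_Ici.1 hs) hsk.symm))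
  · refine (sum_eq_zero fun s hs => ?_).trans_le (Nat.zero_le _)
    exact if_neg (not_le.2 (htk.trans_le (mem_Ici.1 hs)))

/-- A purchase which, on top of `r`, exactly meets `N` services of duration `k`. -/
lemma exists_purchase {T N : ℕ} {r : Fin T → ℕ} (hr : Antitone r) (hN : ∑ t, r t ≤ N)
    (k : Fin T) :
    ∃ y : Fin T → ℕ, MajW (prodDurations fun s => if s = k then N else 0) (fun t => r t + y t) ∧
      ∑ t, r t + ∑ t, y t = N * ((k : ℕ) + 1) := by
  have hr1 : ∀ s, r s ≤ N := fun s => (single_le_sum (by simp) (mem_univ s)).trans hN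
  have htk : ∑ s ∈ Ici k, r s ≤ N := (sum_le_sum_of_subset (subset_univ _)).trans hN
  have hIci : Ici k = insert k (Ioi k) := by ext; simp [le_iff_eq_or_lt]
  have hk : ∑ s ∈ Ici k, r s = r k + ∑ s ∈ Ioi k, r s := by
    rw [hIci, sum_insert (by simp)]
  set y : Fin T → ℕ := fun s =>
    if s < k then N - r s else if s = k then N - ∑ s ∈ Ici k, r s else 0 with hy
  have hlt : ∀ s < k, r s + y s = N := fun s hs => by
    have := hr1 s
    simp only [hy, if_pos hs]
    lia
  have hgt : ∀ s, k < s → r s + y s = r s := fun s hs => by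
    simp [hy, hs.not_gt, hs.ne']
  have hyk : y k = N - ∑ s ∈ Ici k, r s := by simp [hy]
  have htail : ∑ s ∈ Ici k, (r s + y s) = N := by
    rw [hIci, sum_insert (by simp), sum_congr rfl fun s hs => hgt s (mem_Ioi.1 hs)]
    lia
  have hanti : Antitone fun t => r t + y t := by
    have hle : ∀ t, k ≤ t → r t + y t ≤ N := fun t ht => htail ▸
      single_le_sum (f := fun s => r s + y s) (by simp) (mem_Ici.2 ht)
    intro s t hst
    change r t + y t ≤ r s + y s
    rcases lt_or_ge s k with hs | hs
    · rw [hlt s hs]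
      rcases lt_or_ge t k with ht | ht
      · exact (hlt t ht).le
      · exact hle t ht
    · rcases eq_or_lt_of_le hst with rfl | hst'
      · rfl
      · rw [hgt t (hs.trans_lt hst')]
        exact (hr hst).trans (Nat.le_add_right _ _)
  refine ⟨y, majW_prodDurations_single hanti hlt htail, ?_⟩
  have huniv : (univ : Finset (Fin T)) = Iio k ∪ Ici k := by
    ext s
    simpa using lt_or_ge s k
  have hdisj : Disjoint (Iio k) (Ici k) :=
    disjoint_left.2 fun s hs hs' => absurd (mem_Iio.1 hs) (not_lt.2 (mem_Ici.1 hs'))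
  rw [← sum_add_distrib, huniv, sum_union hdisj, htail,
    sum_congr rfl fun s hs => hlt s (mem_Iio.1 hs)]
  simp
  ring

/-- Supplier revenue under linear prices is bounded by supply. -/
lemma revenue_sub_cost_le {p c : ℝ} (hp : 0 ≤ p) (hpc : p ≤ c) {D R Y : ℕ} (h : D ≤ R + Y) :
    p * D - c * Y ≤ p * R := by
  have h' : (D : ℝ) ≤ R + Y := by exact_mod_cast h
  have hY : (0 : ℝ) ≤ Y := Nat.cast_nonneg _
  nlinarith [mul_le_mul_of_nonneg_left h' hp, mul_le_mul_of_nonneg_right hpc hY]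

/-- First welfare theorem for linear prices: surplus-maximizing demand, a production meeting it,
and a purchase attaining the revenue bound form an efficient equilibrium. -/
lemma efficient_of_linear_price {T N : ℕ} {r n y : Fin T → ℕ} {U π : ℕ → ℝ} {p c : ℝ}
    {h : Fin N → ℕ} (hp : 0 ≤ p) (hpc : p ≤ c) (hπ : ∀ k ≤ T, π k = p * k)
    (hopt : ∀ i, ∀ k ≤ T, U k - p * k ≤ U (h i) - p * h i)
    (hnh : ∑ t : Fin T, n t * ((t : ℕ) + 1) = ∑ i, h i)
    (hbound : p * (∑ i, h i : ℕ) - c * (∑ t, y t : ℕ) = p * (∑ t, r t : ℕ)) :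
    (∀ (n' y' : Fin T → ℕ), MajW (prodDurations n') (fun t => r t + y' t) →
        ∑ t, (n' t : ℝ) * π ((t : ℕ) + 1) - c * ∑ t, (y' t : ℝ) ≤
          ∑ t, (n t : ℝ) * π ((t : ℕ) + 1) - c * ∑ t, (y t : ℝ)) ∧
      (∀ (h' : Fin N → ℕ) (y' : Fin T → ℕ), (∀ i, h' i ≤ T) →
        MajW (durations (T := T) h') (fun t => r t + y' t) →
        ∑ i, U (h' i) - c * ∑ t, (y' t : ℝ) ≤
          ∑ i, U (h i) - c * ∑ t, (y t : ℝ)) := by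
  have hrev : ∀ m : Fin T → ℕ, ∑ t, (m t : ℝ) * π ((t : ℕ) + 1) =
      p * (∑ t : Fin T, m t * ((t : ℕ) + 1) : ℕ) := fun m => by
    push_cast
    rw [mul_sum]
    refine sum_congr rfl fun t _ => ?_
    rw [hπ _ t.isLt]
    push_cast
    ring
  constructor
  · intro n' y' hmaj
    have hle := hmaj.sum_le
    rw [sum_prodDurations, sum_add_distrib] at hle
    have := revenue_sub_cost_le hp hpc hle
    rw [hrev, hrev, hnh]
    simp only [← Nat.cast_sum]
    linarith
  · intro h' y' hT' hmaj
    have hle := hmaj.sum_le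
    rw [sum_durations h' hT', sum_add_distrib] at hle
    have hprofit := revenue_sub_cost_le hp hpc hle
    have hsurplus := sum_le_sum fun i (_ : i ∈ univ) => hopt i (h' i) (hT' i)
    simp only [sum_sub_distrib, ← mul_sum, ← Nat.cast_sum] at hsurplus ⊢
    linarith

/-- If the increments of `f` are nonnegative up to `k` and nonpositive after, `k` maximizes `f`. -/
lemma le_of_increments {T k : ℕ} {f : ℕ → ℝ}
    (hup : ∀ j < k, f j ≤ f (j + 1)) (hdown : ∀ j, k ≤ j → j < T → f (j + 1) ≤ f j) :
    ∀ j ≤ T, f j ≤ f k := by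
  intro j hj
  rcases le_total j k with hjk | hkj
  · exact Nat.decreasingInduction' (P := fun m => f m ≤ f k)
      (fun m hm _ ih => (hup m hm).trans ih) hjk le_rfl
  · induction j, hkj using Nat.le_induction with
    | base => rfl
    | succ m hm ih => exact (hdown m hm hj).trans (ih (by lia))

lemma increment_antitone {T : ℕ} {U : ℕ → ℝ}
    (hU : ∀ k : ℕ, k + 2 ≤ T → U (k + 2) - U (k + 1) ≤ U (k + 1) - U k) {i j : ℕ}
    (hij : i ≤ j) (hj : j < T) : U (j + 1) - U j ≤ U (i + 1) - U i := by
  induction j, hij using Nat.le_induction with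
  | base => rfl
  | succ m hm ih => exact (hU m hj).trans (ih (by lia))

/-- Efficient competitive equilibrium with concave utility: with `r` nonincreasing,
`U` having nonnegative nonincreasing increments, `N > ∑ r_t`, `c ≥ 0`, and
`k* = max{k ∈ {1,…,T} : U(k)−U(k−1) ≥ c}` (`k* = 0` if none), the prices
`π(h) = min(c, U(1))·h` and the production `n_{k*} = N` (if `k* ≥ 1`;
`n_1 = ∑ r_t` if `k* = 0`), all other `n_t = 0`, with consumers purchasing so
that the market clears, form a competitive equilibrium whose allocation
maximizes social welfare. -/
theorem efficient_equilibrium_concave {T N : ℕ} (hT : 0 < T)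
    (r : Fin T → ℕ) (hr : Antitone r)
    (U : ℕ → ℝ) (hU0 : U 0 = 0)
    (hUpos : ∀ k : ℕ, k < T → U k ≤ U (k + 1))
    (hUconc : ∀ k : ℕ, k + 2 ≤ T → U (k + 2) - U (k + 1) ≤ U (k + 1) - U k)
    (c : ℝ) (hc : 0 ≤ c)
    (hN : ∑ t, r t < N)
    (kstar : ℕ)
    (hk1 : (∃ k, 1 ≤ k ∧ k ≤ T ∧ c ≤ U k - U (k - 1)) →
      1 ≤ kstar ∧ kstar ≤ T ∧ c ≤ U kstar - U (kstar - 1) ∧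
        ∀ j, kstar < j → j ≤ T → ¬ c ≤ U j - U (j - 1))
    (hk2 : (¬ ∃ k, 1 ≤ k ∧ k ≤ T ∧ c ≤ U k - U (k - 1)) → kstar = 0)
    -- prices: `π(h) = min(c, U(1))·h` on `{0,…,T}`
    (π : ℕ → ℝ) (hπ : ∀ k ≤ T, π k = min c (U 1) * k)
    -- the supplier's production vector (`n t` = number of duration-`(t+1)` services)
    (n : Fin T → ℕ)
    (hn1 : 1 ≤ kstar → ∀ t : Fin T, n t = if (t : ℕ) + 1 = kstar then N else 0)
    (hn2 : kstar = 0 → ∀ t : Fin T, n t = if (t : ℕ) = 0 then ∑ s, r s else 0) :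
    ∃ (hprof : Fin N → ℕ) (y : Fin T → ℕ),
      (∀ i, hprof i ≤ T) ∧
      -- (i) consumer surplus maximization
      (∀ i, ∀ k ≤ T, U k - π k ≤ U (hprof i) - π (hprof i)) ∧
      -- (ii) profit maximization by the supplier
      MajW (prodDurations n) (fun t => r t + y t) ∧
      (∀ (n' y' : Fin T → ℕ), MajW (prodDurations n') (fun t => r t + y' t) →
        ∑ t, (n' t : ℝ) * π ((t : ℕ) + 1) - c * ∑ t, (y' t : ℝ) ≤
          ∑ t, (n t : ℝ) * π ((t : ℕ) + 1) - c * ∑ t, (y t : ℝ)) ∧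
      -- (iii) market clearing
      (∀ t : Fin T, n t = (univ.filter fun i => hprof i = (t : ℕ) + 1).card) ∧
      -- efficiency: the resulting allocation maximizes social welfare
      (∀ (h' : Fin N → ℕ) (y' : Fin T → ℕ), (∀ i, h' i ≤ T) →
        MajW (durations (T := T) h') (fun t => r t + y' t) →
        ∑ i, U (h' i) - c * ∑ t, (y' t : ℝ) ≤
          ∑ i, U (hprof i) - c * ∑ t, (y t : ℝ)) := by
  rcases Nat.eq_zero_or_pos kstar with hk0 | hkpos
  · have hU1c : U 1 < c := by
      by_contra! hle
      have := (hk1 ⟨1, le_rfl, hT, by simpa [hU0] using hle⟩).1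
      lia
    have hU1 : 0 ≤ U 1 := by simpa [hU0] using hUpos 0 hT
    rw [min_eq_right hU1c.le] at hπ
    have hn : n = fun s => if s = ⟨0, hT⟩ then ∑ s, r s else 0 := by
      funext s
      rw [hn2 hk0 s]
      simp [Fin.ext_iff]
    obtain ⟨y, hmaj, hsum⟩ := exists_purchase hr le_rfl ⟨0, hT⟩
    have hy : ∑ t, y t = 0 := by
      simp only [zero_add, mul_one] at hsum
      lia
    set h : Fin N → ℕ := fun i => if (i : ℕ) < ∑ s, r s then 1 else 0 with hh
    have hhsum : ∑ i, h i = ∑ s, r s := by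
      simp only [hh]
      rw [← card_filter, Fin.card_filter_val_lt]
      exact min_eq_right hN.le
    have hzero : ∀ k ≤ T, U k - U 1 * k ≤ U 0 - U 1 * (0 : ℕ) := by
      refine le_of_increments (f := fun k => U k - U 1 * k) (by simp) fun j _ hj => ?_
      have := increment_antitone hUconc (Nat.zero_le j) hj
      simp only [hU0, zero_add] at this
      push_cast
      linarith
    have hopt : ∀ i, ∀ k ≤ T, U k - U 1 * k ≤ U (h i) - U 1 * h i := by
      intro i k hk
      refine (hzero k hk).trans_eq ?_
      by_cases hi : (i : ℕ) < ∑ s, r s <;> simp [hh, hi, hU0]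
    have hle : ∀ i, h i ≤ T := fun i => by
      simp only [hh]
      split_ifs <;> lia
    have heff := efficient_of_linear_price (r := r) (n := n) (y := y) hU1 hU1c.le hπ hopt
      (by simp [hn, hhsum]) (by rw [hhsum, hy]; simp)
    refine ⟨h, y, hle, fun i k hk => ?_, hn ▸ hmaj, heff.1, fun t => ?_, heff.2⟩
    · rw [hπ k hk, hπ _ (hle i)]
      exact hopt i k hk
    · rw [hn2 hk0 t]
      by_cases ht : (t : ℕ) = 0
      · rw [if_pos ht, ht, ← hhsum, card_filter]
        refine sum_congr rfl fun i _ => ?_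
        by_cases hi : (i : ℕ) < ∑ s, r s <;> simp [hh, hi]
      · rw [if_neg ht, eq_comm, card_eq_zero, filter_eq_empty_iff]
        intro i _
        simp only [hh]
        split_ifs <;> lia
  · have hex : ∃ k, 1 ≤ k ∧ k ≤ T ∧ c ≤ U k - U (k - 1) := by
      by_contra hne
      exact hkpos.ne' (hk2 hne)
    obtain ⟨-, hkT, hkc, hafter⟩ := hk1 hex
    obtain ⟨m, rfl⟩ : ∃ m, kstar = m + 1 := ⟨kstar - 1, by lia⟩
    simp only [Nat.add_sub_cancel] at hkc
    have hup : ∀ j < m + 1, c ≤ U (j + 1) - U j := fun j hj =>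
      hkc.trans (increment_antitone hUconc (by lia) (by lia))
    have hcU1 : c ≤ U 1 := by simpa [hU0] using hup 0 (by lia)
    rw [min_eq_left hcU1] at hπ
    have hn : n = fun s => if s = ⟨m, hkT⟩ then N else 0 := by
      funext s
      rw [hn1 hkpos s]
      simp [Fin.ext_iff]
    obtain ⟨y, hmaj, hsum⟩ := exists_purchase hr hN.le ⟨m, hkT⟩
    have hopt : ∀ k ≤ T, U k - c * k ≤ U (m + 1) - c * (m + 1 : ℕ) := by
      refine le_of_increments (f := fun k => U k - c * k) (fun j hj => ?_) fun j hmj hj => ?_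
      · have := hup j hj
        push_cast
        linarith
      · have := hafter (j + 1) (by lia) hj
        simp only [Nat.add_sub_cancel] at this
        push_cast
        linarith
    have heff := efficient_of_linear_price (r := r) (n := n) (y := y) (h := fun _ : Fin N => m + 1)
      hc le_rfl hπ (fun _ => hopt) (by simp [hn]) (by
        have hsum' : ((∑ t, r t : ℕ) : ℝ) + (∑ t, y t : ℕ) = N * ((m : ℝ) + 1) := by
          exact_mod_cast hsum
        have hconst : ((∑ _i : Fin N, (m + 1) : ℕ) : ℝ) = N * ((m : ℝ) + 1) := by simp
        rw [hconst, ← hsum']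
        ring)
    refine ⟨fun _ => m + 1, y, fun _ => hkT, fun _ k hk => ?_, hn ▸ hmaj, heff.1, fun t => ?_,
      heff.2⟩
    · rw [hπ k hk, hπ _ hkT]
      exact hopt k hk
    · rw [hn1 hkpos t]
      by_cases ht : (t : ℕ) = m
      · simp [ht]
      · simp [ht, Ne.symm ht]
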